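/- arXiv:2306.05794 — 2 statements merged into one kernel-verified Lean document; each statement's English description precedes it below -/
import Mathlib

section
/- Let K be a field, M a finitely generated Lie algebra over K, and i ≥ 1 a natural number. If there exists an i-central extension 0 → R → L → M → 0 of Lie algebras over K with γ_{i+1}(L) finitely generated as a Lie algebra, then γ_{i+1}(M) is finitely generated as a Lie algebra. -/
/-- A Lie algebra `A` over `K` is finitely generated (as a Lie algebra):
there is a finite subset generating `A` as a Lie algebra. -/
def LieAlgebraFG (K A : Type*) [Field K] [LieRing A] [LieAlgebra K A] : Prop :=
  ∃ S : Finset A, LieSubalgebra.lieSpan K A ↑S = ⊤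

/-- A Lie algebra `A` over `K` is finitely presented: it is isomorphic to the
quotient of the free Lie algebra on a finite set by an ideal generated (as an
ideal) by finitely many elements. -/
def LieAlgebraFP (K A : Type*) [Field K] [LieRing A] [LieAlgebra K A] : Prop :=
  ∃ (n : ℕ) (S : Finset (FreeLieAlgebra K (Fin n))),
    Nonempty ((FreeLieAlgebra K (Fin n) ⧸
      (LieSubmodule.lieSpan K (FreeLieAlgebra K (Fin n))
        (↑S : Set (FreeLieAlgebra K (Fin n))) :
          LieIdeal K (FreeLieAlgebra K (Fin n)))) ≃ₗ⁅K⁆ A)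

/-- `gammaRel K L R j = γ_{j+1}(R, L)` : `γ_1(R, L) = R` and
`γ_{j+1}(R, L) = ⁅γ_j(R, L), L⁆`. -/
def gammaRel (K L : Type*) [Field K] [LieRing L] [LieAlgebra K L]
    (R : LieIdeal K L) : ℕ → LieIdeal K L
  | 0 => R
  | j + 1 => ⁅gammaRel K L R j, (⊤ : LieIdeal K L)⁆

/-- `gammaLCS K M i = γ_{i+1}(M)` : the lower central series `γ_1(M) = M`,
`γ_{i+1}(M) = ⁅γ_i(M), M⁆`. -/
def gammaLCS (K M : Type*) [Field K] [LieRing M] [LieAlgebra K M] (i : ℕ) : LieIdeal K M :=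
  gammaRel K M ⊤ i

universe u v

theorem LieAlgebraFG.of_surjective {K A B : Type*} [Field K] [LieRing A] [LieAlgebra K A]
    [LieRing B] [LieAlgebra K B] (f : A →ₗ⁅K⁆ B) (hf : Function.Surjective f)
    (hA : LieAlgebraFG K A) : LieAlgebraFG K B := by
  classical
  obtain ⟨S, hS⟩ := hA
  refine ⟨S.image f, ?_⟩
  rw [Finset.coe_image, ← LieSubalgebra.map_lieSpan, hS, ← LieHom.range_eq_map]
  exact f.range_eq_top.mpr hf

theorem map_gammaLCS {K L M : Type*} [Field K] [LieRing L] [LieAlgebra K L]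
    [LieRing M] [LieAlgebra K M] (f : L →ₗ⁅K⁆ M) (hf : Function.Surjective f) (i : ℕ) :
    (gammaLCS K L i).map f = gammaLCS K M i := by
  induction i with
  | zero =>
    change LieIdeal.map f ⊤ = ⊤
    rw [← f.idealRange_eq_map, f.idealRange_eq_top_of_surjective hf]
  | succ i ih =>
    change LieIdeal.map f ⁅gammaLCS K L i, (⊤ : LieIdeal K L)⁆ =
      ⁅gammaLCS K M i, (⊤ : LieIdeal K M)⁆
    rw [LieIdeal.map_bracket_eq f hf, ih, ← f.idealRange_eq_map,
      f.idealRange_eq_top_of_surjective hf]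

theorem gamma_fg_of_icentral_ext (K : Type*) [Field K]
    (M : Type u) [LieRing M] [LieAlgebra K M]
    (hM : LieAlgebraFG K M) (i : ℕ) (hi : 1 ≤ i)
    (L : Type v) [LieRing L] [LieAlgebra K L] (π : L →ₗ⁅K⁆ M)
    (hsurj : Function.Surjective π) (hcent : gammaRel K L π.ker i = ⊥)
    (hγL : LieAlgebraFG K ↑(gammaLCS K L i)) :
    LieAlgebraFG K ↑(gammaLCS K M i) := by
  have hmem (y : M) : y ∈ gammaLCS K M i ↔ ∃ x ∈ gammaLCS K L i, π x = y := by
    rw [← map_gammaLCS π hsurj i, ← LieSubmodule.mem_toSubmodule,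
      LieIdeal.coe_map_of_surjective hsurj]
    rfl
  let f : gammaLCS K L i →ₗ⁅K⁆ gammaLCS K M i :=
    { toFun := fun x => ⟨π x, (hmem _).2 ⟨x, x.2, rfl⟩⟩
      map_add' := fun x y => Subtype.ext (map_add π (x : L) y)
      map_smul' := fun c x => Subtype.ext (map_smul π c (x : L))
      map_lie' := fun {x y} => Subtype.ext (π.map_lie (x : L) y) }
  refine LieAlgebraFG.of_surjective f (fun y => ?_) hγL
  obtain ⟨x, hx, hxy⟩ := (hmem y).1 y.2
  exact ⟨⟨x, hx⟩, Subtype.ext hxy⟩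
end

section
/- Let K be a field, M a finitely presented Lie algebra over K, and i ≥ 1 a natural number. If γ_{i+1}(M) is finitely presented, then for every i-central extension 0 → R → L → M → 0 of Lie algebras over K, the Lie algebra γ_{i+1}(L) is finitely presented. -/
universe u v

namespace FreeLieAlgebra

variable {K X : Type*} [Field K]

/-- A property of elements of a free Lie algebra that holds for the generators and is preserved by
the Lie algebra operations holds everywhere. -/
theorem induction_on {p : FreeLieAlgebra K X → Prop} (f : FreeLieAlgebra K X)
    (of : ∀ i, p (of K i)) (zero : p 0) (add : ∀ a b, p a → p b → p (a + b))
    (smul : ∀ (c : K) a, p a → p (c • a)) (lie : ∀ a b, p a → p b → p ⁅a, b⁆) : p f := by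
  let H : LieSubalgebra K (FreeLieAlgebra K X) :=
    { carrier := {x | p x}
      add_mem' := fun ha hb ↦ add _ _ ha hb
      zero_mem' := zero
      smul_mem' := fun c _ ha ↦ smul c _ ha
      lie_mem' := fun ha hb ↦ lie _ _ ha hb }
  let q : FreeLieAlgebra K X →ₗ⁅K⁆ H := lift K fun i ↦ ⟨FreeLieAlgebra.of K i, of i⟩
  have hq : H.incl.comp q = LieHom.id := by
    ext i
    simp [q]
  have := LieHom.congr_fun hq f
  rw [LieHom.id_apply, LieHom.comp_apply] at this
  rw [← this]
  exact (q f).2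

/-- An additive subgroup stable under bracketing with the generators is stable under all
brackets. -/
theorem lie_mem_of_of_lie_mem {V : Type*} [AddCommGroup V] [Module K V]
    [LieRingModule (FreeLieAlgebra K X) V] [LieModule K (FreeLieAlgebra K X) V]
    {T : Submodule K V} (h : ∀ i : X, ∀ t ∈ T, ⁅of K i, t⁆ ∈ T) (f : FreeLieAlgebra K X) :
    ∀ t ∈ T, ⁅f, t⁆ ∈ T := by
  induction f using induction_on with
  | of i => exact h i
  | zero => simp
  | add a b ha hb =>
    intro t ht
    rw [add_lie]
    exact T.add_mem (ha t ht) (hb t ht)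
  | smul c a ha =>
    intro t ht
    rw [smul_lie]
    exact T.smul_mem c (ha t ht)
  | lie a b ha hb =>
    intro t ht
    rw [lie_lie]
    exact T.sub_mem (ha _ (hb t ht)) (hb _ (ha t ht))

/-- Modulo its generators, an ideal of a free Lie algebra is spanned by the brackets of its elements
with the free generators. -/
theorem lieSpan_le_span_sup (S : Set (FreeLieAlgebra K X)) :
    (LieSubmodule.lieSpan K (FreeLieAlgebra K X) S : LieIdeal K (FreeLieAlgebra K X)).toSubmodule ≤
      Submodule.span K S ⊔ ⨆ i, (LieSubmodule.lieSpan K (FreeLieAlgebra K X) S).toSubmodule.map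
        (LieAlgebra.ad K (FreeLieAlgebra K X) (of K i) : Module.End K (FreeLieAlgebra K X)) := by
  set I : LieIdeal K (FreeLieAlgebra K X) := LieSubmodule.lieSpan K (FreeLieAlgebra K X) S
  set T := Submodule.span K S ⊔ ⨆ i, I.toSubmodule.map
    (LieAlgebra.ad K (FreeLieAlgebra K X) (of K i) : Module.End K (FreeLieAlgebra K X))
  have hTI : T ≤ I.toSubmodule := by
    refine sup_le (Submodule.span_le.2 LieSubmodule.subset_lieSpan) (iSup_le fun i ↦ ?_)
    rintro _ ⟨s, hs, rfl⟩
    exact lie_mem_right K _ I (of K i) s hs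
  have hT : ∀ i, ∀ t ∈ T, ⁅of K i, t⁆ ∈ T := fun i t ht ↦
    le_sup_right (a := Submodule.span K S)
      (Submodule.mem_iSup_of_mem i (Submodule.mem_map_of_mem (hTI ht)))
  let J : LieIdeal K (FreeLieAlgebra K X) :=
    { T with lie_mem := fun {f t} ht ↦ lie_mem_of_of_lie_mem hT f t ht }
  have hIJ : I ≤ J := LieSubmodule.lieSpan_le.2 fun s hs ↦
    le_sup_left (a := Submodule.span K S) (Submodule.subset_span hs)
  exact hIJ

end FreeLieAlgebra

section gammaRel

variable {K L M : Type*} [Field K] [LieRing L] [LieAlgebra K L] [LieRing M] [LieAlgebra K M]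

theorem gammaRel_le (R : LieIdeal K L) (j : ℕ) : gammaRel K L R j ≤ R := by
  induction j with
  | zero => exact le_rfl
  | succ j ih => exact (LieSubmodule.lie_le_left _ _).trans ih

theorem lie_mem_gammaRel_succ {R : LieIdeal K L} {j : ℕ} {x : L} (hx : x ∈ gammaRel K L R j)
    (y : L) : ⁅x, y⁆ ∈ gammaRel K L R (j + 1) :=
  LieSubmodule.lie_mem_lie hx (LieSubmodule.mem_top y)

theorem lie_mem_gammaRel_succ' {R : LieIdeal K L} {j : ℕ} {x : L} (hx : x ∈ gammaRel K L R j)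
    (y : L) : ⁅y, x⁆ ∈ gammaRel K L R (j + 1) := by
  rw [← lie_skew]
  exact neg_mem (lie_mem_gammaRel_succ hx y)

theorem gammaRel_succ_le_iff {R : LieIdeal K L} {j : ℕ} {T : Submodule K L} :
    (gammaRel K L R (j + 1)).toSubmodule ≤ T ↔ ∀ x ∈ gammaRel K L R j, ∀ y, ⁅x, y⁆ ∈ T := by
  refine ⟨fun h x hx y ↦ h (lie_mem_gammaRel_succ hx y), fun h ↦ ?_⟩
  rw [gammaRel, LieSubmodule.lieIdeal_oper_eq_linear_span', Submodule.span_le]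
  rintro _ ⟨x, hx, y, -, rfl⟩
  exact h x hx y

theorem lie_gammaLCS_gammaRel_mem (R : LieIdeal K L) (j k : ℕ) {x r : L}
    (hx : x ∈ gammaLCS K L j) (hr : r ∈ gammaRel K L R k) :
    ⁅x, r⁆ ∈ gammaRel K L R (j + k + 1) := by
  induction j generalizing x r k with
  | zero =>
    rw [zero_add]
    exact lie_mem_gammaRel_succ' hr x
  | succ j ih =>
    have key : (gammaLCS K L (j + 1)).toSubmodule ≤
        (gammaRel K L R (j + 1 + k + 1)).toSubmodule.comap
          (LieAlgebra.ad K L r : Module.End K L) := by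
      refine gammaRel_succ_le_iff.2 fun a ha b ↦ ?_
      change ⁅r, ⁅a, b⁆⁆ ∈ gammaRel K L R (j + 1 + k + 1)
      rw [← lie_skew, lie_lie]
      refine neg_mem (sub_mem ?_ ?_)
      · have := ih (k + 1) ha (lie_mem_gammaRel_succ' hr b)
        rwa [show j + 1 + k + 1 = j + (k + 1) + 1 by ring]
      · have := lie_mem_gammaRel_succ' (ih k ha hr) b
        rwa [show j + 1 + k + 1 = j + k + 1 + 1 by ring]
    rw [← lie_skew]
    exact neg_mem (key hx)

theorem LieHom.map_mem_gammaRel (f : L →ₗ⁅K⁆ M) {R : LieIdeal K L} {R' : LieIdeal K M}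
    (hR : ∀ x ∈ R, f x ∈ R') (j : ℕ) : ∀ x ∈ gammaRel K L R j, f x ∈ gammaRel K M R' j := by
  induction j with
  | zero => exact hR
  | succ j ih =>
    refine (gammaRel_succ_le_iff (T := (gammaRel K M R' (j + 1)).toSubmodule.comap
      (f : L →ₗ[K] M))).2 fun x hx y ↦ ?_
    change f ⁅x, y⁆ ∈ gammaRel K M R' (j + 1)
    rw [LieHom.map_lie]
    exact lie_mem_gammaRel_succ (ih x hx) _

/-- A homomorphism that is surjective modulo `R` is surjective on lower central series modulo the
relative lower central series of `R`. -/
theorem exists_sub_mem_gammaRel (f : M →ₗ⁅K⁆ L) (R : LieIdeal K L)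
    (h : ∀ x, ∃ y, x - f y ∈ R) (j : ℕ) :
    ∀ x ∈ gammaLCS K L j, ∃ y ∈ gammaLCS K M j, x - f y ∈ gammaRel K L R j := by
  induction j with
  | zero =>
    intro x _
    obtain ⟨y, hy⟩ := h x
    exact ⟨y, LieSubmodule.mem_top y, hy⟩
  | succ j ih =>
    have key : (gammaLCS K L (j + 1)).toSubmodule ≤
        (gammaLCS K M (j + 1)).toSubmodule.map (f : M →ₗ[K] L) ⊔
          (gammaRel K L R (j + 1)).toSubmodule := by
      refine gammaRel_succ_le_iff.2 fun a ha b ↦ ?_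
      obtain ⟨y, hy, hay⟩ := ih a ha
      obtain ⟨z, hz⟩ := h b
      have hfy : f y ∈ gammaLCS K L j :=
        f.map_mem_gammaRel (fun _ _ ↦ LieSubmodule.mem_top _) j y hy
      refine Submodule.mem_sup.2 ⟨f ⁅y, z⁆, ⟨_, lie_mem_gammaRel_succ hy z, rfl⟩,
        ⁅a - f y, b⁆ + ⁅f y, b - f z⁆, add_mem (lie_mem_gammaRel_succ hay b) ?_, ?_⟩
      · exact lie_gammaLCS_gammaRel_mem R j 0 hfy hz
      · rw [LieHom.map_lie, sub_lie, lie_sub]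
        abel
    intro x hx
    obtain ⟨_, ⟨y, hy, rfl⟩, r, hr, rfl⟩ := Submodule.mem_sup.1 (key hx)
    exact ⟨y, hy, by simpa using hr⟩

/-- A finitely generated ideal of a free Lie algebra of finite rank is finite-dimensional modulo
each term of its relative lower central series. -/
theorem exists_finiteDimensional_le_sup_gammaRel {X : Type*} [Finite X]
    (S : Finset (FreeLieAlgebra K X)) (j : ℕ) :
    ∃ W : Submodule K (FreeLieAlgebra K X), FiniteDimensional K W ∧
      (LieSubmodule.lieSpan K (FreeLieAlgebra K X) (S : Set (FreeLieAlgebra K X)) :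
        LieIdeal K (FreeLieAlgebra K X)).toSubmodule ≤
      W ⊔ (gammaRel K (FreeLieAlgebra K X)
        (LieSubmodule.lieSpan K (FreeLieAlgebra K X) (S : Set (FreeLieAlgebra K X))) j).toSubmodule
      := by
  induction j with
  | zero => exact ⟨⊥, inferInstance, le_sup_right⟩
  | succ j ih =>
    obtain ⟨W, hW, hSW⟩ := ih
    have := FiniteDimensional.span_finset K S
    refine ⟨Submodule.span K (S : Set (FreeLieAlgebra K X)) ⊔ ⨆ i, W.map
      (LieAlgebra.ad K (FreeLieAlgebra K X) (FreeLieAlgebra.of K i) :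
        Module.End K (FreeLieAlgebra K X)), inferInstance, ?_⟩
    refine (FreeLieAlgebra.lieSpan_le_span_sup _).trans
      (sup_le (le_sup_left.trans le_sup_left) (iSup_le fun i ↦ ?_))
    refine (Submodule.map_mono hSW).trans ?_
    rw [Submodule.map_sup]
    refine sup_le_sup ((le_iSup (fun i ↦ W.map (LieAlgebra.ad K (FreeLieAlgebra K X)
      (FreeLieAlgebra.of K i) : Module.End K (FreeLieAlgebra K X))) i).trans le_sup_right) ?_
    rintro _ ⟨g, hg, rfl⟩
    exact lie_mem_gammaRel_succ' hg (FreeLieAlgebra.of K i)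

end gammaRel

section FinitelyPresented

variable {K A B : Type*} [Field K] [LieRing A] [LieAlgebra K A] [LieRing B] [LieAlgebra K B]

theorem lieAlgebraFP_iff_exists_lieHom :
    LieAlgebraFP K A ↔ ∃ (n : ℕ) (S : Finset (FreeLieAlgebra K (Fin n)))
      (p : FreeLieAlgebra K (Fin n) →ₗ⁅K⁆ A), Function.Surjective p ∧
        p.ker = LieSubmodule.lieSpan K (FreeLieAlgebra K (Fin n))
          (S : Set (FreeLieAlgebra K (Fin n))) := by
  refine exists_congr fun n ↦ exists_congr fun S ↦ ⟨?_, ?_⟩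
  · rintro ⟨e⟩
    set I : LieIdeal K (FreeLieAlgebra K (Fin n)) := LieSubmodule.lieSpan K _ _
    let q : FreeLieAlgebra K (Fin n) →ₗ⁅K⁆ FreeLieAlgebra K (Fin n) ⧸ I :=
      { LieSubmodule.Quotient.mk' I with
        map_lie' := fun {x y} ↦ LieSubmodule.Quotient.mk_bracket (I := I) x y }
    refine ⟨e.toLieHom.comp q,
      e.surjective.comp (LieSubmodule.Quotient.surjective_mk' I), ?_⟩
    ext x
    rw [LieHom.mem_ker, LieHom.comp_apply]
    change e (q x) = 0 ↔ _
    rw [← LieSubmodule.Quotient.mk_eq_zero]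
    exact map_eq_zero_iff e e.injective
  · rintro ⟨p, hp, hker⟩
    rw [← hker]
    exact ⟨p.quotKerEquivRange.trans
      ((LieEquiv.ofEq _ _ (by rw [p.range_eq_top.2 hp])).trans LieSubalgebra.topEquiv)⟩

/-- An extension of a finitely presented Lie algebra by a finite-dimensional ideal is finitely
presented. -/
theorem LieAlgebraFP.of_surjective_of_finiteDimensional_ker (hB : LieAlgebraFP K B)
    (f : A →ₗ⁅K⁆ B) (hf : Function.Surjective f) [FiniteDimensional K f.ker] :
    LieAlgebraFP K A := by
  classical
  obtain ⟨n, S, p, hp, hker⟩ := lieAlgebraFP_iff_exists_lieHom.1 hB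
  let m := Module.finrank K f.ker
  let b : Module.Basis (Fin m) K f.ker := Module.finBasis K f.ker
  choose a ha using fun i ↦ hf (p (FreeLieAlgebra.of K i))
  let x : Fin n → FreeLieAlgebra K (Fin (n + m)) := fun i ↦ FreeLieAlgebra.of K (Fin.castAdd m i)
  let y : Fin m → FreeLieAlgebra K (Fin (n + m)) := fun j ↦ FreeLieAlgebra.of K (Fin.natAdd n j)
  let φ : FreeLieAlgebra K (Fin (n + m)) →ₗ⁅K⁆ A :=
    FreeLieAlgebra.lift K (Fin.append a fun j ↦ (b j : A))
  have hφx (i : Fin n) : φ (x i) = a i := by simp [φ, x]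
  have hφy (j : Fin m) : φ (y j) = b j := by simp [φ, y]
  let g : FreeLieAlgebra K (Fin n) →ₗ⁅K⁆ FreeLieAlgebra K (Fin (n + m)) := FreeLieAlgebra.lift K x
  let h : FreeLieAlgebra K (Fin (n + m)) →ₗ⁅K⁆ FreeLieAlgebra K (Fin n) :=
    FreeLieAlgebra.lift K (Fin.append (FreeLieAlgebra.of K) 0)
  have hgx (i : Fin n) : g (FreeLieAlgebra.of K i) = x i := by simp [g]
  have hhx (i : Fin n) : h (x i) = FreeLieAlgebra.of K i := by simp [h, x]
  have hhy (j : Fin m) : h (y j) = 0 := by simp [h, y]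
  have hfφ : f.comp φ = p.comp h := by
    ext k
    refine Fin.addCases (fun i ↦ ?_) (fun j ↦ ?_) k
    · change f (φ (x i)) = p (h (x i))
      rw [hφx, ha, hhx]
    · change f (φ (y j)) = p (h (y j))
      rw [hφy, hhy, map_zero]
      exact LieHom.mem_ker.1 (b j).2
  have hφg : f.comp (φ.comp g) = p := by
    ext i
    rw [LieHom.comp_apply, LieHom.comp_apply, hgx, hφx, ha]
  -- `c v` is the linear combination of the `y j` lifting `v`; subtracting it from `w` gives `corr w`
  let c : f.ker →ₗ[K] FreeLieAlgebra K (Fin (n + m)) := b.constr K y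
  have hφc (v : f.ker) : φ (c v) = v := by
    have : (φ : _ →ₗ[K] A) ∘ₗ c = f.ker.toSubmodule.subtype :=
      b.ext fun j ↦ (congrArg φ (b.constr_basis K y j)).trans (hφy j)
    exact LinearMap.congr_fun this v
  let corr : FreeLieAlgebra K (Fin (n + m)) → FreeLieAlgebra K (Fin (n + m)) := fun w ↦
    if hw : f (φ w) = 0 then w - c ⟨φ w, LieHom.mem_ker.2 hw⟩ else 0
  have hφcorr (w) : φ (corr w) = 0 := by
    by_cases hw : f (φ w) = 0
    · simp only [corr, dif_pos hw, map_sub, hφc, sub_self]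
    · simp only [corr, dif_neg hw, map_zero]
  let Rel : Finset (FreeLieAlgebra K (Fin (n + m))) :=
    S.image (fun s ↦ corr (g s)) ∪
      Finset.univ.image (fun kj : Fin (n + m) × Fin m ↦ corr ⁅FreeLieAlgebra.of K kj.1, y kj.2⁆)
  let I : LieIdeal K (FreeLieAlgebra K (Fin (n + m))) :=
    LieSubmodule.lieSpan K _ (Rel : Set (FreeLieAlgebra K (Fin (n + m))))
  have hIker : I ≤ φ.ker := by
    refine LieSubmodule.lieSpan_le.2 fun w hw ↦ ?_
    simp only [Rel, Finset.coe_union, Finset.coe_image, Set.mem_union, Set.mem_image] at hw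
    obtain ⟨_, _, rfl⟩ | ⟨_, _, rfl⟩ := hw <;> exact LieHom.mem_ker.2 (hφcorr _)
  let T : Submodule K (FreeLieAlgebra K (Fin (n + m))) := I.toSubmodule ⊔ LinearMap.range c
  have hcorrT (w) (hw : f (φ w) = 0) (hI : corr w ∈ I) : w ∈ T := by
    refine Submodule.mem_sup.2 ⟨_, hI, _, ⟨⟨φ w, LieHom.mem_ker.2 hw⟩, rfl⟩, ?_⟩
    simp only [corr, dif_pos hw, sub_add_cancel]
  have hyT (k : Fin (n + m)) (j : Fin m) : ⁅FreeLieAlgebra.of K k, y j⁆ ∈ T := by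
    refine hcorrT _ ?_ (LieSubmodule.subset_lieSpan ?_)
    · rw [LieHom.map_lie, LieHom.map_lie, hφy, LieHom.mem_ker.1 (b j).2, lie_zero]
    · simp only [Rel, Finset.coe_union, Finset.coe_image]
      exact Or.inr ⟨(k, j), by simp, rfl⟩
  have hT (k : Fin (n + m)) : ∀ t ∈ T, ⁅FreeLieAlgebra.of K k, t⁆ ∈ T := by
    have : T ≤ T.comap (LieAlgebra.ad K _ (FreeLieAlgebra.of K k) :
        Module.End K (FreeLieAlgebra K (Fin (n + m)))) := by
      refine sup_le (fun t ht ↦ Submodule.mem_sup_left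
        (lie_mem_right K _ I (FreeLieAlgebra.of K k) t ht)) ?_
      rw [Module.Basis.constr_range, Submodule.span_le]
      rintro _ ⟨j, rfl⟩
      exact hyT k j
    exact this
  let J : LieIdeal K (FreeLieAlgebra K (Fin (n + m))) :=
    { T with lie_mem := fun {w t} ht ↦ FreeLieAlgebra.lie_mem_of_of_lie_mem hT w t ht }
  have hyJ (j : Fin m) : y j ∈ J :=
    Submodule.mem_sup_right ⟨b j, by simp [c]⟩
  have hgh (w) : w - g (h w) ∈ J := by
    induction w using FreeLieAlgebra.induction_on with
    | of k =>
      refine Fin.addCases (fun i ↦ ?_) (fun j ↦ ?_) k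
      · change x i - g (h (x i)) ∈ J
        simp [hhx, hgx]
      · change y j - g (h (y j)) ∈ J
        simpa [hhy] using hyJ j
    | zero => simp
    | add u v hu hv =>
      rw [map_add, map_add, add_sub_add_comm]
      exact add_mem hu hv
    | smul r u hu =>
      rw [map_smul, map_smul, ← smul_sub]
      exact J.smul_mem r hu
    | lie u v hu hv =>
      have : ⁅u, v⁆ - g (h ⁅u, v⁆) = ⁅u - g (h u), v⁆ + ⁅g (h u), v - g (h v)⁆ := by
        rw [LieHom.map_lie, LieHom.map_lie, sub_lie, lie_sub]
        abel
      rw [this]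
      exact add_mem (lie_mem_left K _ J _ _ hu) (J.lie_mem hv)
  have hpJ : p.ker ≤ J.comap g := by
    rw [hker]
    refine LieSubmodule.lieSpan_le.2 fun s hs ↦ LieIdeal.mem_comap.2 (hcorrT _ ?_ ?_)
    · have : s ∈ p.ker := hker ▸ LieSubmodule.subset_lieSpan hs
      exact (LieHom.congr_fun hφg s).trans (LieHom.mem_ker.1 this)
    · refine LieSubmodule.subset_lieSpan ?_
      simp only [Rel, Finset.coe_union, Finset.coe_image]
      exact Or.inl ⟨s, hs, rfl⟩
  refine lieAlgebraFP_iff_exists_lieHom.2 ⟨n + m, Rel, φ, fun z ↦ ?_, le_antisymm ?_ hIker⟩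
  · obtain ⟨w, hw⟩ := hp (f z)
    have hz : z - φ (g w) ∈ f.ker := by
      rw [LieHom.mem_ker, map_sub, ← hw, ← LieHom.congr_fun hφg w]
      exact sub_self _
    exact ⟨g w + c ⟨_, hz⟩, by rw [map_add, hφc]; exact add_sub_cancel _ _⟩
  · intro w hw
    rw [LieHom.mem_ker] at hw
    have hhw : h w ∈ p.ker := by
      rw [LieHom.mem_ker, ← LieHom.comp_apply, ← hfφ, LieHom.comp_apply, hw, map_zero]
    have hwJ : w ∈ J := by
      simpa using add_mem (hgh w) (LieIdeal.mem_comap.1 (hpJ hhw))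
    obtain ⟨u, hu, _, ⟨v, rfl⟩, rfl⟩ := Submodule.mem_sup.1 hwJ
    have hv : (v : A) = 0 := by
      rwa [map_add, LieHom.mem_ker.1 (hIker hu), zero_add, hφc] at hw
    obtain rfl : v = 0 := Subtype.ext hv
    simpa using hu

end FinitelyPresented

theorem baer_fp_of_gamma_fp (K : Type*) [Field K] (M : Type u) [LieRing M] [LieAlgebra K M]
    (hM : LieAlgebraFP K M) (i : ℕ) (hi : 1 ≤ i)
    (hγ : LieAlgebraFP K ↑(gammaLCS K M i)) :
    ∀ (L : Type v) [LieRing L] [LieAlgebra K L] (π : L →ₗ⁅K⁆ M),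
      Function.Surjective π → gammaRel K L π.ker i = ⊥ →
        LieAlgebraFP K ↑(gammaLCS K L i) := by
  intro L _ _ π hπ hR
  obtain ⟨n, S, p, hp, hker⟩ := lieAlgebraFP_iff_exists_lieHom.1 hM
  choose l hl using fun k ↦ hπ (p (FreeLieAlgebra.of K k))
  let φ : FreeLieAlgebra K (Fin n) →ₗ⁅K⁆ L := FreeLieAlgebra.lift K l
  have hπφ : π.comp φ = p := by
    ext k
    simp [φ, hl]
  have hπφ' (w) : π (φ w) = p w := LieHom.congr_fun hπφ w
  have hφR (x : L) : ∃ w, x - φ w ∈ π.ker := by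
    obtain ⟨w, hw⟩ := hp (π x)
    exact ⟨w, by rw [LieHom.mem_ker, map_sub, hπφ', hw, sub_self]⟩
  have hrange (x) (hx : x ∈ gammaLCS K L i) : ∃ w, φ w = x := by
    obtain ⟨w, -, hw⟩ := exists_sub_mem_gammaRel φ π.ker hφR i x hx
    rw [hR, LieSubmodule.mem_bot, sub_eq_zero] at hw
    exact ⟨w, hw.symm⟩
  let ρ : gammaLCS K L i →ₗ⁅K⁆ gammaLCS K M i :=
    { toFun := fun x ↦ ⟨π x, π.map_mem_gammaRel (fun _ _ ↦ LieSubmodule.mem_top _) i x x.2⟩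
      map_add' := fun x y ↦ Subtype.ext (map_add π (x : L) y)
      map_smul' := fun c x ↦ Subtype.ext (map_smul π c (x : L))
      map_lie' := fun {x y} ↦ Subtype.ext (LieHom.map_lie π (x : L) y) }
  have hρ : Function.Surjective ρ := by
    rintro ⟨z, hz⟩
    obtain ⟨x, hx, hzx⟩ := exists_sub_mem_gammaRel π ⊥
      (fun z ↦ (hπ z).imp fun x hx ↦ by simp [hx]) i z hz
    have := gammaRel_le _ _ hzx
    rw [LieSubmodule.mem_bot, sub_eq_zero] at this
    exact ⟨⟨x, hx⟩, Subtype.ext this.symm⟩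
  obtain ⟨W, hW, hSW⟩ := exists_finiteDimensional_le_sup_gammaRel S i
  rw [← hker] at hSW
  have hφker (w) (hw : w ∈ p.ker) : φ w ∈ π.ker := by
    rw [LieHom.mem_ker, hπφ']
    exact LieHom.mem_ker.1 hw
  have hφW (w) (hw : w ∈ p.ker) : φ w ∈ W.map (φ : _ →ₗ[K] L) := by
    obtain ⟨v, hv, r, hr, rfl⟩ := Submodule.mem_sup.1 (hSW hw)
    have hφr := φ.map_mem_gammaRel hφker i r hr
    rw [hR, LieSubmodule.mem_bot] at hφr
    exact ⟨v, hv, by simp [hφr]⟩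
  have hρW (x : ρ.ker) : ((x : gammaLCS K L i) : L) ∈ W.map (φ : _ →ₗ[K] L) := by
    obtain ⟨w, hw⟩ := hrange _ (x : gammaLCS K L i).2
    rw [← hw]
    refine hφW w ?_
    rw [LieHom.mem_ker, ← hπφ', hw]
    exact congrArg Subtype.val (LieHom.mem_ker.1 x.2)
  let ι : ρ.ker →ₗ[K] L :=
    (gammaLCS K L i).toSubmodule.subtype ∘ₗ ρ.ker.toSubmodule.subtype
  have : FiniteDimensional K ρ.ker := by
    refine FiniteDimensional.of_injective (ι.codRestrict (W.map (φ : _ →ₗ[K] L)) hρW) fun x y hxy ↦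
      Subtype.ext (Subtype.ext ?_)
    exact congrArg (fun v : W.map (φ : _ →ₗ[K] L) ↦ (v : L)) hxy
  exact hγ.of_surjective_of_finiteDimensional_ker ρ hρ
end
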